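/- arXiv:2605.18034 — 2 statements merged into one kernel-verified Lean document; each statement's English description precedes it below -/
import Mathlib

section
/- Let φ : Σ* → Γ* be an injective morphism and let L be a set of words over Σ. If φ is interference-free on L, then φ is recognizable on L. -/
/-- Extension of a letter map `φ` to a morphism on words. -/
def wlift {α β : Type*} (φ : α → List β) (u : List α) : List β := (u.map φ).flatten

/-- Set of starting positions (0-indexed) of occurrences of `u` in `w`. -/
def Occ {β : Type*} (u w : List β) : Set ℕ := {i | i ≤ w.length ∧ u <+: w.drop i}

/-- Number of occurrences of `u` as a factor of `w`. -/
noncomputable def occ {β : Type*} (u w : List β) : ℕ := (Occ u w).ncard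

/-- `w` admits a `φ`-image factorization. -/
def ImageFact {α β : Type*} (φ : α → List β) (w : List β) : Prop :=
  ∃ s : List α, w = wlift φ s

/-- `w` admits an interfered `φ`-image factorization. -/
def InterferedFact {α β : Type*} (φ : α → List β) (w : List β) : Prop :=
  ∃ x y z : List β, w = x ++ y ++ z ∧
    (∃ c : α, x <:+ φ c ∧ x ≠ φ c) ∧
    ImageFact φ y ∧
    (∃ c' : α, z <+: φ c' ∧ z ≠ φ c') ∧
    x ++ z ≠ []

/-- `w` is an inner `φ`-image factor. -/
def InnerImageFactor {α β : Type*} (φ : α → List β) (w : List β) : Prop :=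
  ∃ c : α, w <:+: φ c ∧ ¬ w <+: φ c ∧ ¬ w <:+ φ c

/-- `φ` is interference-free on the set `L` of words. -/
def InterferenceFree {α β : Type*} (φ : α → List β) (L : Set (List α)) : Prop :=
  ∀ u ∈ L, u ≠ [] →
    ¬ InterferedFact φ (wlift φ u) ∧ ¬ InnerImageFactor φ (wlift φ u)

/-- `t = (q, r, p)` is a circular `φ`-image factorization of `w`. -/
def CircFact {α β : Type*} (φ : α → List β) (w : List β)
    (t : List β × List β × List β) : Prop :=
  w = t.1 ++ t.2.1 ++ t.2.2 ∧ ImageFact φ t.2.1 ∧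
    (∃ c : α, t.2.2 ++ t.1 = φ c) ∧ t.2.2 ≠ []

/-- `φ` is recognizable on the set `L` of words. -/
def Recognizable {α β : Type*} (φ : α → List β) (L : Set (List α)) : Prop :=
  ∀ u ∈ L, u ≠ [] → ∀ i : ℕ, i < (wlift φ u).length →
    ∃! t : List β × List β × List β,
      CircFact φ ((wlift φ u).drop i ++ (wlift φ u).take i) t

theorem wlift_append {α β : Type*} (φ : α → List β) (u v : List α) :
    wlift φ (u ++ v) = wlift φ u ++ wlift φ v := by
  simp [wlift]

theorem wlift_cons {α β : Type*} (φ : α → List β) (c : α) (u : List α) :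
    wlift φ (c :: u) = φ c ++ wlift φ u := by
  simp [wlift]

theorem wlift_nil {α β : Type*} (φ : α → List β) : wlift φ [] = [] := rfl

/-- A non-empty prefix of `φ u` ends inside, or at the end of, the image of a letter of `u`. -/
theorem exists_split_of_wlift_eq_append {α β : Type*} (φ : α → List β) (u : List α)
    (A B : List β) (h : wlift φ u = A ++ B) (hA : A ≠ []) :
    ∃ s c t p q, u = s ++ c :: t ∧ φ c = p ++ q ∧ A = wlift φ s ++ p ∧
      B = q ++ wlift φ t ∧ p ≠ [] := by
  induction u generalizing A with
  | nil =>
    simp only [wlift_nil, List.nil_eq, List.append_eq_nil_iff] at h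
    exact absurd h.1 hA
  | cons a u ih =>
    rw [wlift_cons, List.append_eq_append_iff] at h
    rcases h with ⟨A', rfl, hB⟩ | ⟨q, hq, rfl⟩
    · by_cases hA' : A' = []
      · subst hA'
        exact ⟨[], a, u, φ a, [], by simp, by simp, by simp [wlift_nil], by simpa using hB.symm,
          by simpa using hA⟩
      · obtain ⟨s, c, t, p, q, rfl, hc, rfl, rfl, hp⟩ := ih A' hB hA'
        exact ⟨a :: s, c, t, p, q, by simp, hc, by simp [wlift_cons], rfl, hp⟩
    · exact ⟨[], a, u, A, q, by simp, hq, by simp [wlift_nil], rfl, hA⟩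

/-- The position at which a non-empty prefix of `φ u` ends is located in a unique letter of `u`. -/
theorem split_unique {α β : Type*} (φ : α → List β) {s s' t t' : List α} {c c' : α}
    {p p' q q' : List β} (hu : s ++ c :: t = s' ++ c' :: t')
    (hc : φ c = p ++ q) (hc' : φ c' = p' ++ q') (hA : wlift φ s ++ p = wlift φ s' ++ p')
    (hp : p ≠ []) (hp' : p' ≠ []) :
    s = s' ∧ c = c' ∧ t = t' ∧ p = p' ∧ q = q' := by
  have hlen := congrArg List.length hA
  have hpos := List.length_pos_of_ne_nil hp
  have hpos' := List.length_pos_of_ne_nil hp'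
  rw [List.append_eq_append_iff] at hu
  rcases hu with ⟨v, rfl, hv⟩ | ⟨v, rfl, hv⟩ <;> cases v with
  | nil =>
    simp only [List.nil_append, List.cons.injEq] at hv
    obtain ⟨rfl, rfl⟩ := hv
    obtain rfl : p = p' := by simpa using hA
    simpa using hc.symm.trans hc'
  | cons d v =>
    simp only [List.cons_append, List.cons.injEq] at hv
    obtain ⟨rfl, -⟩ := hv
    simp only [wlift_append, wlift_cons, List.length_append, hc, hc'] at hlen
    omega

/-- Without interference, every circular factorization of a conjugate of `φ u` is the one
coming from `u`. -/
theorem CircFact.exists_split {α β : Type*} {φ : α → List β}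
    (hinj : Function.Injective (wlift φ)) {u : List α} {A B q r p : List β}
    (hif : ¬ InterferedFact φ (wlift φ u)) (h : wlift φ u = A ++ B) (hA : A ≠ [])
    (ht : CircFact φ (B ++ A) (q, r, p)) :
    ∃ s c t, u = s ++ c :: t ∧ φ c = p ++ q ∧ A = wlift φ s ++ p ∧
      r = wlift φ t ++ wlift φ s ∧ p ≠ [] := by
  obtain ⟨hBA, ⟨s, hs⟩, ⟨c, hc⟩, hp⟩ := ht
  dsimp only at hBA hs hc hp
  rw [List.append_assoc, List.append_eq_append_iff] at hBA
  rcases hBA with ⟨x, rfl, rfl⟩ | ⟨x, rfl, hx⟩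
  · by_cases hx0 : x = []
    · subst hx0
      refine ⟨s, c, [], hinj ?_, hc.symm, by simp [hs], by simp [hs, wlift_nil], hp⟩
      rw [h, wlift_append, wlift_cons, ← hc, ← hs]
      simp [wlift_nil]
    · refine absurd ⟨x, r, p ++ B, by simp [h], ⟨c, ⟨p ++ B, by simp [← hc]⟩, ?_⟩, ⟨s, hs⟩,
        ⟨c, ⟨x, by simp [← hc]⟩, ?_⟩, by simp [hx0]⟩ hif
      · rw [← hc]
        intro e
        have := congrArg List.length e
        have := List.length_pos_of_ne_nil hp
        simp at *
        omega
      · simpa [← hc] using hx0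
  · rw [List.append_eq_append_iff] at hx
    rcases hx with ⟨p₁, rfl, rfl⟩ | ⟨r₂, rfl, rfl⟩
    · by_cases hp₁ : p₁ = []
      · subst hp₁
        refine ⟨[], c, s, hinj ?_, by simp [← hc], by simp [wlift_nil], by simp [hs, wlift_nil],
          hp⟩
        simp [h, wlift_cons, ← hc, ← hs]
      · refine absurd ⟨A ++ q, r, p₁, by simp [h], ⟨c, ⟨p₁, by simp [← hc]⟩, ?_⟩, ⟨s, hs⟩,
          ⟨c, ⟨A ++ q, by simp [← hc]⟩, ?_⟩, by simp [hp₁]⟩ hif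
        · simpa [← hc] using hp₁
        · simp [← hc, hA]
    · by_cases hx0 : x = []
      · subst hx0
        refine ⟨s, c, [], hinj ?_, hc.symm, by simp [← hs], by simp [← hs, wlift_nil], hp⟩
        rw [h, wlift_append, wlift_cons, ← hc, ← hs]
        simp [wlift_nil]
      · obtain ⟨s₁, d, s₂, d₁, d₂, rfl, hd, rfl, rfl, hd₁⟩ :=
          exists_split_of_wlift_eq_append φ s x r₂ hs.symm hx0
        by_cases hd₂ : d₂ = []
        · subst hd₂
          refine ⟨s₂, c, s₁ ++ [d], hinj ?_, hc.symm, by simp,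
            by simp [wlift_append, wlift_cons, wlift_nil, hd], hp⟩
          simp [h, wlift_append, wlift_cons, wlift_nil, hd, ← hc]
        · refine absurd ⟨d₂, wlift φ (s₂ ++ c :: s₁), d₁,
            by simp [h, wlift_append, wlift_cons, ← hc],
            ⟨d, ⟨d₁, hd.symm⟩, by simpa [hd] using hd₁⟩, ⟨_, rfl⟩,
            ⟨d, ⟨d₂, hd.symm⟩, by simpa [hd] using hd₂⟩, by simp [hd₁]⟩ hif

theorem existsUnique_circFact {α β : Type*} {φ : α → List β}
    (hinj : Function.Injective (wlift φ)) {u : List α} {A B : List β}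
    (hif : ¬ InterferedFact φ (wlift φ u)) (h : wlift φ u = A ++ B) (hA : A ≠ []) :
    ∃! t : List β × List β × List β, CircFact φ (B ++ A) t := by
  obtain ⟨s, c, t, p, q, rfl, hc, rfl, rfl, hp⟩ := exists_split_of_wlift_eq_append φ u A B h hA
  refine ⟨(q, wlift φ t ++ wlift φ s, p),
    ⟨by simp, ⟨t ++ s, (wlift_append φ t s).symm⟩, ⟨c, hc.symm⟩, hp⟩, ?_⟩
  rintro ⟨q', r', p'⟩ ht
  obtain ⟨s', c', t', hu, hc', hA', rfl, hp'⟩ := ht.exists_split hinj hif h hA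
  obtain ⟨rfl, rfl, rfl, rfl, rfl⟩ := split_unique φ hu hc hc' hA' hp hp'
  rfl

theorem if_implies_recognizable {α β : Type*} (φ : α → List β)
    (hinj : Function.Injective (wlift φ)) (L : Set (List α))
    (hif : InterferenceFree φ L) :
    Recognizable φ L := by
  intro u hu hne i hi
  have hif' := (hif u hu hne).1
  rcases Nat.eq_zero_or_pos i with rfl | hpos
  · simpa using existsUnique_circFact hinj hif' (List.append_nil _).symm
      (List.ne_nil_of_length_pos hi)
  · refine existsUnique_circFact hinj hif' (List.take_append_drop i _).symm
      (List.ne_nil_of_length_pos ?_)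
    rw [List.length_take]
    omega
end

section
/- For all natural numbers i, j, d with i ≥ j and j ≥ d + 2, occ(T_{i−d}, T_i) = occ(T_{j−d}, T_j) and occ(flip(T_{i−d}), T_i) = occ(flip(T_{j−d}), T_j), where T_k is the Thue-Morse word of order k. -/
/-- The binary alphabet. -/
inductive Ltr : Type
  | a : Ltr
  | b : Ltr

/-- The Fibonacci morphism: a ↦ ab, b ↦ a. -/
def fib : Ltr → List Ltr
  | Ltr.a => [Ltr.a, Ltr.b]
  | Ltr.b => [Ltr.a]

/-- The Fibonacci word of order `i`: `F i = φ^{i-1}(b)`. -/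
def F (i : ℕ) : List Ltr := (wlift fib)^[i - 1] [Ltr.b]

/-- The Thue-Morse morphism: a ↦ ab, b ↦ ba. -/
def tm : Ltr → List Ltr
  | Ltr.a => [Ltr.a, Ltr.b]
  | Ltr.b => [Ltr.b, Ltr.a]

/-- The Thue-Morse word of order `i`: `T i = μ^{i-1}(a)`. -/
def T (i : ℕ) : List Ltr := (wlift tm)^[i - 1] [Ltr.a]

/-- Exchange the letters a and b. -/
def flipLetter : Ltr → Ltr
  | Ltr.a => Ltr.b
  | Ltr.b => Ltr.a

/-- Exchange the letters a and b in a word. -/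
def flipWord (w : List Ltr) : List Ltr := w.map flipLetter

theorem wlift_tm_nil : wlift tm [] = [] := rfl

theorem wlift_tm_cons (x : Ltr) (w : List Ltr) :
    wlift tm (x :: w) = x :: flipLetter x :: wlift tm w := by
  cases x <;> simp [wlift, tm, flipLetter]

theorem length_wlift_tm (w : List Ltr) : (wlift tm w).length = 2 * w.length := by
  induction w with
  | nil => rfl
  | cons x w ih => rw [wlift_tm_cons]; simp only [List.length_cons, ih]; omega

theorem drop_wlift_tm (w : List Ltr) (k : ℕ) :
    (wlift tm w).drop (2 * k) = wlift tm (w.drop k) := by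
  induction k generalizing w with
  | zero => simp
  | succ k ih =>
    cases w with
    | nil => simp [wlift_tm_nil]
    | cons x w =>
      rw [wlift_tm_cons, show 2 * (k + 1) = 2 * k + 1 + 1 by ring]
      simpa using ih w

theorem wlift_tm_prefix_iff (u v : List Ltr) : wlift tm u <+: wlift tm v ↔ u <+: v := by
  induction u generalizing v with
  | nil => simp [wlift_tm_nil]
  | cons x u ih =>
    cases v with
    | nil => rw [wlift_tm_cons]; simp [wlift_tm_nil]
    | cons y v =>
      simp only [wlift_tm_cons, List.cons_prefix_cons, ih]
      exact ⟨fun h => ⟨h.1, h.2.2⟩, fun h => ⟨h.1, h.1 ▸ rfl, h.2⟩⟩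

/-- The image of a word starting with two distinct letters does not occur at odd positions. -/
theorem not_wlift_tm_prefix_drop_one (x : Ltr) (u v : List Ltr) :
    ¬ wlift tm (x :: flipLetter x :: u) <+: (wlift tm v).drop 1 := by
  rcases v with _ | ⟨y, _ | ⟨z, v⟩⟩
  · simp [wlift_tm_cons, wlift_tm_nil]
  · simp [wlift_tm_cons, wlift_tm_nil]
  · simp only [wlift_tm_cons, List.drop_succ_cons, List.drop_zero, List.cons_prefix_cons]
    rintro ⟨-, h₁, h₂, -⟩
    cases x <;> cases z <;> simp [flipLetter] at h₁ h₂

theorem Occ_wlift_tm (x : Ltr) (u w : List Ltr) :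
    Occ (wlift tm (x :: flipLetter x :: u)) (wlift tm w) =
      (fun k => 2 * k) '' Occ (x :: flipLetter x :: u) w := by
  ext m
  simp only [Occ, Set.mem_ofPred_eq, Set.mem_image, length_wlift_tm]
  constructor
  · rintro ⟨hm, hp⟩
    rcases Nat.even_or_odd' m with ⟨k, rfl | rfl⟩
    · rw [drop_wlift_tm, wlift_tm_prefix_iff] at hp
      exact ⟨k, ⟨by omega, hp⟩, rfl⟩
    · rw [← List.drop_drop, drop_wlift_tm] at hp
      exact absurd hp (not_wlift_tm_prefix_drop_one _ _ _)
  · rintro ⟨k, ⟨hk, hp⟩, rfl⟩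
    exact ⟨by omega, by rwa [drop_wlift_tm, wlift_tm_prefix_iff]⟩

theorem occ_wlift_tm (x : Ltr) (u w : List Ltr) :
    occ (wlift tm (x :: flipLetter x :: u)) (wlift tm w) = occ (x :: flipLetter x :: u) w := by
  rw [occ, Occ_wlift_tm, Set.ncard_image_of_injective _ (fun k l h => by simpa using h), occ]

theorem exists_iterate_wlift_tm (x : Ltr) (n : ℕ) :
    ∃ u, (wlift tm)^[n + 1] [x] = x :: flipLetter x :: u := by
  induction n with
  | zero => exact ⟨[], by simp [wlift_tm_cons, wlift_tm_nil]⟩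
  | succ n ih =>
    obtain ⟨u, hu⟩ := ih
    exact ⟨_, by rw [Function.iterate_succ_apply', hu, wlift_tm_cons]⟩

theorem occ_iterate_wlift_tm (x : Ltr) (w : List Ltr) (n : ℕ) :
    occ ((wlift tm)^[n + 1] [x]) ((wlift tm)^[n] w) = occ (wlift tm [x]) w := by
  induction n with
  | zero => simp
  | succ n ih =>
    obtain ⟨u, hu⟩ := exists_iterate_wlift_tm x n
    rw [Function.iterate_succ_apply' _ (n + 1), Function.iterate_succ_apply' _ n w, ← ih, hu,
      occ_wlift_tm]

theorem flipWord_wlift_tm (w : List Ltr) : flipWord (wlift tm w) = wlift tm (flipWord w) := by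
  induction w with
  | nil => rfl
  | cons x w ih =>
    simp only [flipWord, List.map_cons, wlift_tm_cons] at ih ⊢
    rw [ih]

theorem flipWord_iterate_wlift_tm (w : List Ltr) (n : ℕ) :
    flipWord ((wlift tm)^[n] w) = (wlift tm)^[n] (flipWord w) :=
  Function.Semiconj.iterate_right (f := flipWord) flipWord_wlift_tm n w

theorem occ_iterate_wlift_tm_T (x : Ltr) (i d : ℕ) (h : d + 2 ≤ i) :
    occ ((wlift tm)^[i - d - 1] [x]) (T i) = occ (wlift tm [x]) ((wlift tm)^[d + 1] [Ltr.a]) := by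
  obtain ⟨n, rfl⟩ := Nat.exists_eq_add_of_le h
  rw [T, show d + 2 + n - d - 1 = n + 1 by omega, show d + 2 + n - 1 = n + (d + 1) by omega,
    Function.iterate_add_apply _ n (d + 1), occ_iterate_wlift_tm]

theorem occ_tm_i_d :
    ∀ i j d : ℕ, j ≤ i → d + 2 ≤ j →
      occ (T (i - d)) (T i) = occ (T (j - d)) (T j) ∧
      occ (flipWord (T (i - d))) (T i) = occ (flipWord (T (j - d))) (T j) := by
  intro i j d hij hj
  have hi := hj.trans hij
  constructor
  · rw [T.eq_1 (i - d), T.eq_1 (j - d), occ_iterate_wlift_tm_T _ i d hi,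
      occ_iterate_wlift_tm_T _ j d hj]
  · rw [T.eq_1 (i - d), T.eq_1 (j - d), flipWord_iterate_wlift_tm, flipWord_iterate_wlift_tm]
    exact (occ_iterate_wlift_tm_T Ltr.b i d hi).trans (occ_iterate_wlift_tm_T Ltr.b j d hj).symm
end
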